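/- Let T ∈ ℝ and let ω : ℝ⁴ → ℝ⁴ be a smooth map such that ω(p) = 0 for every p with p₀ = T, and such that Σ_{λ=0}^{3} ∂_λ∂_λ ω_μ(p) = 0 for every μ ∈ {0,1,2,3} and every p with p₀ = T. Then u := Kω satisfies the linearised Anderson boundary conditions on the hyperplane {p₀ = T}, namely at every point p with p₀ = T: (a,b) (δu)_μ(p) = 0 for every μ ∈ {0,1,2,3}; (c) u_{ij}(p) = (1/3)·(Σ_{k=1}^{3} u_{kk}(p))·δ_{ij} for all i,j ∈ {1,2,3}; and (d) ∂₀(Σ_{k=1}^{3} u_{kk})(p) − ∂₀u_{00}(p) = 0. -/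

import Mathlib

open scoped BigOperators

/-- Partial derivative `∂_μ f` of a scalar function on `ℝ⁴`. -/
noncomputable def pd (μ : Fin 4) (f : (Fin 4 → ℝ) → ℝ) : (Fin 4 → ℝ) → ℝ :=
  fun p => deriv (fun t => f (Function.update p μ t)) (p μ)

/-- The symmetrised gradient `(dω)_{μν} = (1/2)(∂_μ ω_ν + ∂_ν ω_μ)`. -/
noncomputable def symGrad (ω : (Fin 4 → ℝ) → Fin 4 → ℝ) :
    (Fin 4 → ℝ) → Matrix (Fin 4) (Fin 4) ℝ :=
  fun p => Matrix.of fun μ ν =>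
    (1 / 2 : ℝ) * (pd μ (fun q => ω q ν) p + pd ν (fun q => ω q μ) p)

/-- The flat trace reversal `I(v)_{μν} = v_{μν} − (1/2)(Σ_λ v_{λλ})δ_{μν}`. -/
noncomputable def traceRev (v : Matrix (Fin 4) (Fin 4) ℝ) : Matrix (Fin 4) (Fin 4) ℝ :=
  Matrix.of fun μ ν =>
    v μ ν - (1 / 2 : ℝ) * (∑ lam : Fin 4, v lam lam) * (if μ = ν then 1 else 0)

/-- The gauge operator `K = I ∘ d`. -/
noncomputable def Kop (ω : (Fin 4 → ℝ) → Fin 4 → ℝ) :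
    (Fin 4 → ℝ) → Matrix (Fin 4) (Fin 4) ℝ :=
  fun p => traceRev (symGrad ω p)

/-- The divergence `(δu)_μ = −2·Σ_λ ∂_λ u_{λμ}`. -/
noncomputable def divg (u : (Fin 4 → ℝ) → Matrix (Fin 4) (Fin 4) ℝ) :
    (Fin 4 → ℝ) → Fin 4 → ℝ :=
  fun p μ => -2 * ∑ lam : Fin 4, pd lam (fun q => u q lam μ) p

/-- The flat linearised Einstein operator
`(Pu)_{μν} = −Σ_λ ∂_λ∂_λ u_{μν} − (I(d(δu)))_{μν}`. -/
noncomputable def Pop (u : (Fin 4 → ℝ) → Matrix (Fin 4) (Fin 4) ℝ) :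
    (Fin 4 → ℝ) → Matrix (Fin 4) (Fin 4) ℝ :=
  fun p => Matrix.of fun μ ν =>
    -(∑ lam : Fin 4, pd lam (pd lam (fun q => u q μ ν)) p)
      - traceRev (symGrad (divg u) p) μ ν

theorem pd_eq_fderiv (μ : Fin 4) (f : (Fin 4 → ℝ) → ℝ) (hf : Differentiable ℝ f) (p : Fin 4 → ℝ) :
    pd μ f p = fderiv ℝ f p (Pi.single μ 1) := by
  have h1 : HasDerivAt (fun t => Function.update p μ t) (Pi.single μ (1 : ℝ)) (p μ) :=
    hasDerivAt_update p μ (p μ)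
  have h2 : HasFDerivAt f (fderiv ℝ f p) (Function.update p μ (p μ)) := by
    rw [Function.update_eq_self]
    exact (hf p).hasFDerivAt
  exact (h2.comp_hasDerivAt (p μ) h1).deriv

theorem pd_smooth (μ : Fin 4) (f : (Fin 4 → ℝ) → ℝ) (hf : ContDiff ℝ (⊤ : ℕ∞) f) :
    ContDiff ℝ (⊤ : ℕ∞) (pd μ f) := by
  have hd : Differentiable ℝ f := hf.differentiable (by simp)
  have : pd μ f = fun p => fderiv ℝ f p (Pi.single μ 1) := funext (pd_eq_fderiv μ f hd)
  rw [this]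
  exact (hf.fderiv_right (m := (⊤ : ℕ∞)) (by simp)).clm_apply contDiff_const

theorem pd_pd_comm (μ ν : Fin 4) (f : (Fin 4 → ℝ) → ℝ) (hf : ContDiff ℝ (⊤ : ℕ∞) f)
    (p : Fin 4 → ℝ) : pd μ (pd ν f) p = pd ν (pd μ f) p := by
  have hd : Differentiable ℝ f := hf.differentiable (by simp)
  have hdd : Differentiable ℝ (fderiv ℝ f) :=
    (hf.fderiv_right (m := (⊤ : ℕ∞)) (by simp)).differentiable (by simp)
  have key : ∀ a b : Fin 4, pd a (pd b f) p
      = fderiv ℝ (fderiv ℝ f) p (Pi.single a 1) (Pi.single b 1) := by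
    intro a b
    rw [pd_eq_fderiv a _ ((pd_smooth b f hf).differentiable (by simp))]
    have : pd b f = fun p => fderiv ℝ f p (Pi.single b 1) := funext (pd_eq_fderiv b f hd)
    rw [this, fderiv_clm_apply (hdd p) (differentiableAt_const _)]
    simp
  rw [key, key]
  have hs : IsSymmSndFDerivAt ℝ f p := by
    apply hf.contDiffAt.isSymmSndFDerivAt
    simp only [minSmoothness_of_isRCLikeNormedField]
    exact WithTop.coe_le_coe.2 (le_top : (2 : ℕ∞) ≤ ⊤)
  exact hs _ _

theorem pd_tangent (T : ℝ) (f : (Fin 4 → ℝ) → ℝ) (hf : ∀ p, p 0 = T → f p = 0) (k : Fin 3)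
    (p : Fin 4 → ℝ) (hp : p 0 = T) : pd k.succ f p = 0 := by
  have : (fun t => f (Function.update p k.succ t)) = fun _ => 0 := by
    funext t
    apply hf
    rw [Function.update_of_ne (Fin.succ_ne_zero k).symm, hp]
  simp [pd, this]

theorem pd_Kop (ω : (Fin 4 → ℝ) → Fin 4 → ℝ) (hω : ContDiff ℝ (⊤ : ℕ∞) ω)
    (lam μ ν : Fin 4) (p : Fin 4 → ℝ) :
    Differentiable ℝ (fun q => Kop ω q μ ν) ∧
    pd lam (fun q => Kop ω q μ ν) p =
      (1 / 2 : ℝ) * (pd lam (pd μ (fun q => ω q ν)) p + pd lam (pd ν (fun q => ω q μ)) p)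
      - (1 / 2 : ℝ) * (∑ k : Fin 4, pd lam (pd k (fun q => ω q k)) p)
        * (if μ = ν then 1 else 0) := by
  have hd : ∀ a b : Fin 4, Differentiable ℝ (pd a (fun q => ω q b)) := fun a b =>
    (pd_smooth a _ (contDiff_pi.1 hω b)).differentiable (by simp)
  have hK : (fun q => Kop ω q μ ν) = fun q =>
      (1 / 2 : ℝ) * (pd μ (fun q => ω q ν) q + pd ν (fun q => ω q μ) q)
      - (1 / 2 : ℝ) * (∑ k : Fin 4, pd k (fun q => ω q k) q)
        * (if μ = ν then 1 else 0) := by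
    funext q
    simp only [Kop, traceRev, symGrad, Matrix.of_apply]
    congr 3
    exact Finset.sum_congr rfl fun k _ => by ring
  have hF : ∀ q, HasFDerivAt (fun q => Kop ω q μ ν)
      ((1 / 2 : ℝ) • (fderiv ℝ (pd μ (fun q => ω q ν)) q + fderiv ℝ (pd ν (fun q => ω q μ)) q)
      - (if μ = ν then (1 : ℝ) else 0) •
        ((1 / 2 : ℝ) • (∑ k : Fin 4, fderiv ℝ (pd k (fun q => ω q k)) q))) q := by
    intro q
    rw [hK]
    exact (((hd μ ν q).hasFDerivAt.add (hd ν μ q).hasFDerivAt).const_mul (1 / 2 : ℝ)).sub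
      (((HasFDerivAt.fun_sum fun k _ => (hd k k q).hasFDerivAt).const_mul (1 / 2 : ℝ)).mul_const _)
  have hD : Differentiable ℝ (fun q => Kop ω q μ ν) := fun q => (hF q).differentiableAt
  refine ⟨hD, ?_⟩
  rw [pd_eq_fderiv lam _ hD, (hF p).fderiv]
  simp only [fun a b => pd_eq_fderiv lam _ (hd a b) p]
  split_ifs <;> simp <;> ring

/-- Gauge invariance of the linearised Anderson boundary conditions in
the flat model: if the gauge parameter `ω` vanishes on the hyperplane `{p₀ = T}` and
is componentwise harmonic there, then `u = Kω` satisfies on that hyperplane the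
harmonic-gauge condition `δu = 0`, the linearised conformal-class condition, and the
linearised fixed-mean-curvature condition. -/
theorem stmt_12 (T : ℝ) (ω : (Fin 4 → ℝ) → Fin 4 → ℝ) (hω : ContDiff ℝ (⊤ : ℕ∞) ω)
    (hdir : ∀ p : Fin 4 → ℝ, p 0 = T → ω p = 0)
    (hharm : ∀ (μ : Fin 4) (p : Fin 4 → ℝ), p 0 = T →
      ∑ lam : Fin 4, pd lam (pd lam (fun q => ω q μ)) p = 0) :
    ∀ p : Fin 4 → ℝ, p 0 = T →
      (∀ μ : Fin 4, divg (Kop ω) p μ = 0) ∧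
      (∀ i j : Fin 3, Kop ω p i.succ j.succ
        = (1 / 3 : ℝ) * (∑ k : Fin 3, Kop ω p k.succ k.succ) * (if i = j then 1 else 0)) ∧
      (pd 0 (fun q => ∑ k : Fin 3, Kop ω q k.succ k.succ) p
        - pd 0 (fun q => Kop ω q 0 0) p = 0) := by
  intro p hp
  have hs : ∀ b : Fin 4, ContDiff ℝ (⊤ : ℕ∞) (fun q => ω q b) := fun b => contDiff_pi.1 hω b
  have h0 : ∀ (b : Fin 4) (q : Fin 4 → ℝ), q 0 = T → (fun q => ω q b) q = 0 := by
    intro b q hq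
    simp [hdir q hq]
  have h1 : ∀ (k : Fin 3) (b : Fin 4) (q : Fin 4 → ℝ), q 0 = T →
      pd k.succ (fun q => ω q b) q = 0 := fun k b q hq => pd_tangent T _ (h0 b) k q hq
  have h2 : ∀ (j k : Fin 3) (b : Fin 4), pd j.succ (pd k.succ (fun q => ω q b)) p = 0 :=
    fun j k b => pd_tangent T _ (h1 k b) j p hp
  have h00 : ∀ b : Fin 4, pd 0 (pd 0 (fun q => ω q b)) p = 0 := by
    intro b
    have := hharm b p hp
    rw [Fin.sum_univ_succ] at this
    simpa [h2] using this
  refine ⟨?_, ?_, ?_⟩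
  · intro μ
    have hh := hharm μ p hp
    have hc : ∀ k : Fin 4, pd k (pd μ (fun q => ω q k)) p = pd μ (pd k (fun q => ω q k)) p :=
      fun k => pd_pd_comm k μ _ (hs k) p
    simp only [divg, fun a b c => (pd_Kop ω hω a b c p).2, hc]
    rw [Finset.sum_sub_distrib, ← Finset.mul_sum, Finset.sum_add_distrib, hh]
    simp
  · intro i j
    simp only [Kop, traceRev, symGrad, Matrix.of_apply, Fin.sum_univ_succ (n := 3), h1 _ _ p hp,
      Fin.succ_inj]
    simp
    split_ifs <;> ring
  · have hsum : pd 0 (fun q => ∑ k : Fin 3, Kop ω q k.succ k.succ) p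
        = ∑ k : Fin 3, pd 0 (fun q => Kop ω q k.succ k.succ) p := by
      have hd : ∀ k : Fin 3, Differentiable ℝ (fun q => Kop ω q k.succ k.succ) :=
        fun k => (pd_Kop ω hω 0 k.succ k.succ p).1
      have hF := HasFDerivAt.fun_sum (u := Finset.univ) fun k (_ : k ∈ Finset.univ) => (hd k p).hasFDerivAt
      rw [pd_eq_fderiv 0 _ (Differentiable.fun_sum fun k _ => hd k), hF.fderiv]
      simp only [fun k => pd_eq_fderiv 0 _ (hd k) p, sum_apply]
    rw [hsum]
    simp only [fun a b c => (pd_Kop ω hω a b c p).2, Fin.sum_univ_succ (n := 3), h00]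
    simp [Fin.sum_univ_three]
    ring
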